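/- A vector ψ ∈ H_N is alignable if and only if there exist a function c : G^{N−1} → G and complex coefficients (α_h)_{h∈G^{N−1}} such that ψ = Σ_{h∈G^{N−1}} α_h |c(h), h c(h)⟩; equivalently, for every h ∈ G^{N−1} the orthogonal projection of ψ onto H_h is a scalar multiple of a single standard basis vector. Moreover, the coefficients characterize alignable vectors up to symmetry equivalence: for two alignable vectors ψ, ψ' with coefficient families (α_h), (α'_h) (where α_h is the unique nonzero standard-basis coefficient of the projection of ψ onto H_h, or 0 if that projection vanishes), one has ψ ≃ ψ' if and only if there exists θ ∈ ℝ with α'_h = e^{iθ} α_h for all h ∈ G^{N−1}. -/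

import Mathlib

noncomputable section

open Matrix

namespace QRF

section Defs

variable (G : Type) [Fintype G] [DecidableEq G] [CommGroup G]

/-- The `K`-particle Hilbert space `ℂ^{G^K}` (as functions `G^K → ℂ`). -/
abbrev Vec (K : ℕ) : Type := (Fin K → G) → ℂ

/-- Linear operators on the `K`-particle Hilbert space. -/
abbrev Op (K : ℕ) : Type := Matrix (Fin K → G) (Fin K → G) ℂ

variable {G}

/-- The standard basis vector `|x⟩`. -/
def ket {K : ℕ} (x : Fin K → G) : Vec G K := fun y => if y = x then 1 else 0

/-- The global translation `T_g`, `T_g |x₁,…,x_K⟩ = |g x₁, …, g x_K⟩`. -/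
def trans {K : ℕ} (g : G) : Op G K :=
  Matrix.of fun x y => if x = (fun i => g * y i) then 1 else 0

/-- The configuration `(g, h₁ g, …, h_k g)`, i.e. `|g, hg⟩`. -/
def cfg {k : ℕ} (h : Fin k → G) (g : G) : Fin (k + 1) → G :=
  Fin.cons g fun i => h i * g

/-- The inner product `⟨v, w⟩` (antilinear in the first argument). -/
def inn {K : ℕ} (v w : Vec G K) : ℂ := star v ⬝ᵥ w

/-- The rank-one operator `|v⟩⟨w|`. -/
def outer {K : ℕ} (v w : Vec G K) : Op G K :=
  Matrix.of fun x y => v x * (starRingEnd ℂ) (w y)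

/-- The matrix element `⟨v|A|w⟩`. -/
def melem {K : ℕ} (v : Vec G K) (A : Op G K) (w : Vec G K) : ℂ :=
  star v ⬝ᵥ A.mulVec w

/-- The Hilbert–Schmidt inner product `⟨A,B⟩ := tr(A† B)`. -/
def hsInner {K : ℕ} (A B : Op G K) : ℂ := (Aᴴ * B).trace

variable (G)

/-- The symmetry group `U_sym` of relation-conditional global translations
(for `k+1` particles). -/
def Usym (k : ℕ) : Set (Op G (k + 1)) :=
  {U | U ∈ Matrix.unitaryGroup (Fin (k + 1) → G) ℂ ∧
    ∃ c : (Fin k → G) → G, ∀ (h : Fin k → G) (g : G),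
      U.mulVec (ket (cfg h g)) = (trans (c h)).mulVec (ket (cfg h g))}

/-- The characters of `G`: monoid homomorphisms `G → ℂ` of modulus one. -/
def Ghat : Type := {χ : G →* ℂ // ∀ g : G, ‖χ g‖ = 1}

/-- The trivial character `𝟙`. -/
instance : One (Ghat G) := ⟨⟨1, fun g => by simp⟩⟩

variable {G}

/-- The vector `|h;χ⟩ := |G|^{-1/2} ∑_{g ∈ G} χ(g⁻¹) |g, hg⟩`. -/
def relKet {k : ℕ} (h : Fin k → G) (χ : Ghat G) : Vec G (k + 1) :=
  ((Real.sqrt (Fintype.card G) : ℂ))⁻¹ • ∑ g : G, χ.1 g⁻¹ • ket (cfg h g)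

variable (G)

/-- The relational subspace `H_phys = span{|h;𝟙⟩}`. -/
def Hphys (k : ℕ) : Submodule ℂ (Vec G (k + 1)) :=
  Submodule.span ℂ {v | ∃ h : Fin k → G, v = relKet h (1 : Ghat G)}

/-- `Π_phys = ∑_h |h;𝟙⟩⟨h;𝟙|`, the orthogonal projection onto `H_phys`. -/
def Piphys (k : ℕ) : Op G (k + 1) :=
  ∑ h : Fin k → G, outer (relKet h (1 : Ghat G)) (relKet h (1 : Ghat G))

variable {G}

/-- `Π_{h;χ≠𝟙} = ∑_{χ ∈ Ĝ, χ ≠ 𝟙} |h;χ⟩⟨h;χ|`. -/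
def PiNot1 {k : ℕ} (h : Fin k → G) : Op G (k + 1) :=
  ∑ᶠ (χ : Ghat G) (_ : χ ≠ 1), outer (relKet h χ) (relKet h χ)

variable (G)

/-- The invariant algebra `A_inv`. -/
def Ainv (k : ℕ) : Set (Op G (k + 1)) :=
  {A | ∀ U ∈ Usym G k, U * A * Uᴴ = A}

/-- The incoherent group average (twirl) `Π_inv` over `U_sym`. -/
def Piinv (k : ℕ) (ρ : Op G (k + 1)) : Op G (k + 1) :=
  (Nat.card ↥(Usym G k) : ℂ)⁻¹ • ∑ᶠ U ∈ Usym G k, U * ρ * Uᴴ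

/-- The algebra `A_phys` of relational observables (operators supported on `H_phys`). -/
def Aphys (k : ℕ) : Set (Op G (k + 1)) :=
  {A | A = Piphys G k * A * Piphys G k}

/-- The algebra `A_alg`. -/
def Aalg (k : ℕ) : Set (Op G (k + 1)) :=
  {X | ∃ B ∈ Aphys G k, ∃ a : (Fin k → G) → ℂ,
      X = B + ∑ h : Fin k → G, a h • PiNot1 h}

variable {G}

/-- The vector `|e⟩_i ⊗ φ`. -/
def insVec {k : ℕ} (i : Fin (k + 1)) (φ : (Fin k → G) → ℂ) : Vec G (k + 1) :=
  fun x => if x i = 1 then φ (fun j => x (i.succAbove j)) else 0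

/-- The operator `|e⟩⟨e|_i ⊗ A`. -/
def eAop {k : ℕ} (i : Fin (k + 1)) (A : Matrix (Fin k → G) (Fin k → G) ℂ) :
    Op G (k + 1) :=
  Matrix.of fun x y =>
    if x i = 1 ∧ y i = 1 then
      A (fun j => x (i.succAbove j)) (fun j => y (i.succAbove j))
    else 0

/-- `ψ` is `i`-alignable. -/
def IAlignable {k : ℕ} (i : Fin (k + 1)) (ψ : Vec G (k + 1)) : Prop :=
  ∃ (θ : ℝ) (U : Op G (k + 1)) (φ : (Fin k → G) → ℂ),
    U ∈ Usym G k ∧ ψ = Complex.exp (θ * Complex.I) • U.mulVec (insVec i φ)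

/-- `ψ` is alignable. -/
def Alignable {k : ℕ} (ψ : Vec G (k + 1)) : Prop := ∃ i, IAlignable i ψ

/-- Symmetry equivalence of state vectors (up to a global phase). -/
def SymmEquiv {k : ℕ} (ψ ψ' : Vec G (k + 1)) : Prop :=
  ∃ (θ : ℝ) (U : Op G (k + 1)),
    U ∈ Usym G k ∧ ψ' = Complex.exp (θ * Complex.I) • U.mulVec ψ

/-- `P` is the orthogonal projection of operator space onto the set `S`,
with respect to the Hilbert–Schmidt inner product. -/
def IsHSProj {K : ℕ} (S : Set (Op G K)) (P : Op G K →ₗ[ℂ] Op G K) : Prop :=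
  (∀ ρ, P ρ ∈ S) ∧ (∀ A ∈ S, P A = A) ∧
    ∀ ρ σ, hsInner (P ρ) σ = hsInner ρ (P σ)

/-- First `n+1` components of an `(n+1)+(m+1)`-particle configuration. -/
def split1 {n m : ℕ} (x : Fin (n + m + 1 + 1) → G) : Fin (n + 1) → G :=
  fun i => x ⟨i.1, by have := i.2; omega⟩

/-- Last `m+1` components of an `(n+1)+(m+1)`-particle configuration. -/
def split2 {n m : ℕ} (x : Fin (n + m + 1 + 1) → G) : Fin (m + 1) → G :=
  fun i => x ⟨n + 1 + i.1, by have := i.2; omega⟩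

/-- The tensor product `A ⊗ B` of operators, under the identification
`H_{N+M} ≅ H_N ⊗ H_M`, `|x,y⟩ ↦ |x⟩ ⊗ |y⟩`. -/
def tensorOp {n m : ℕ} (A : Op G (n + 1)) (B : Op G (m + 1)) :
    Op G (n + m + 1 + 1) :=
  Matrix.of fun x y => A (split1 x) (split1 y) * B (split2 x) (split2 y)

/-- Concatenation `(h, g⃗)` of relation tuples. -/
def relcat {n m : ℕ} (h : Fin n → G) (gv : Fin (m + 1) → G) :
    Fin (n + m + 1) → G :=
  (Fin.append h gv : Fin (n + (m + 1)) → G)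

/-- Joining of configurations `(x, z)`. -/
def join {n m : ℕ} (x : Fin (n + 1) → G) (z : Fin (m + 1) → G) :
    Fin (n + m + 1 + 1) → G :=
  fun i => if hi : i.1 < n + 1 then x ⟨i.1, hi⟩
           else z ⟨i.1 - (n + 1), by have := i.2; omega⟩

/-- The standard partial trace over the last `m+1` particles. -/
def ptraceM {n m : ℕ} (ρ : Op G (n + m + 1 + 1)) : Op G (n + 1) :=
  Matrix.of fun x y => ∑ z : Fin (m + 1) → G, ρ (join x z) (join y z)

end Defs

section Lemmas

lemma mulVec_ket {G : Type} [Fintype G] [DecidableEq G] {K : ℕ} (U : Op G K) (x y : Fin K → G) :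
    U.mulVec (ket y) x = U x y := by
  simp [Matrix.mulVec, dotProduct, ket]

variable {G : Type} [CommGroup G] {k : ℕ}

/-- The relation tuple `h` of a configuration `(g, hg)`. -/
def rel (x : Fin (k + 1) → G) : Fin k → G := fun i => x i.succ * (x 0)⁻¹

lemma rel_cfg (h : Fin k → G) (g : G) : rel (cfg h g) = h := by
  ext i; simp [rel, cfg]

lemma cfg_rel (x : Fin (k + 1) → G) : cfg (rel x) (x 0) = x := by
  ext i; refine Fin.cases ?_ (fun j => ?_) i <;> simp [rel, cfg]

lemma cfg_inj {h h' : Fin k → G} {g g' : G} : cfg h g = cfg h' g' ↔ h = h' ∧ g = g' := by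
  refine ⟨fun e => ⟨?_, ?_⟩, fun ⟨a, b⟩ => by rw [a, b]⟩
  · rw [← rel_cfg h g, e, rel_cfg]
  · simpa [cfg] using congrFun e 0

lemma mul_cfg (a : G) (h : Fin k → G) (g : G) :
    (fun i => a * cfg h g i) = cfg h (a * g) := by
  ext i; refine Fin.cases ?_ (fun j => ?_) i <;> simp [cfg, mul_left_comm]

lemma cfg_apply (h : Fin k → G) (g : G) (i : Fin (k + 1)) : cfg h g i = cfg h 1 i * g := by
  refine Fin.cases ?_ (fun j => ?_) i <;> simp [cfg]

lemma vec_ext {ψ ψ' : Vec G (k + 1)} (H : ∀ h g, ψ (cfg h g) = ψ' (cfg h g)) : ψ = ψ' := by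
  funext x; rw [← cfg_rel x]; exact H _ _

variable [Fintype G] [DecidableEq G]

lemma sum_ket_apply (α : (Fin k → G) → ℂ) (c : (Fin k → G) → G) (h : Fin k → G) (g : G) :
    (∑ h', α h' • ket (cfg h' (c h')) : Vec G (k + 1)) (cfg h g)
      = if g = c h then α h else 0 := by
  rw [Finset.sum_apply, Finset.sum_eq_single h]
  · simp [ket, cfg_inj]
  · intro b _ hb
    simp [ket, cfg_inj, hb.symm]
  · simp

/-- An operator acting as the relation-conditional translation by `c` acts on coefficients by
the inverse translation. -/
lemma mulVec_cfg {U : Op G (k + 1)} {c : (Fin k → G) → G}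
    (hU : ∀ h g, U.mulVec (ket (cfg h g)) = (trans (c h)).mulVec (ket (cfg h g)))
    (ψ : Vec G (k + 1)) (h : Fin k → G) (g : G) :
    U.mulVec ψ (cfg h g) = ψ (cfg h ((c h)⁻¹ * g)) := by
  have entry : ∀ h' g', U (cfg h g) (cfg h' g') = if h = h' ∧ g = c h' * g' then 1 else 0 := by
    intro h' g'
    rw [← mulVec_ket U, hU, mulVec_ket]
    simp [trans, mul_cfg, cfg_inj]
  rw [Matrix.mulVec, dotProduct, Finset.sum_eq_single (cfg h ((c h)⁻¹ * g))]
  · simp [entry]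
  · intro y _ hy
    rw [← cfg_rel y] at hy ⊢
    rw [entry, if_neg, zero_mul]
    rintro ⟨rfl, rfl⟩
    simp at hy
  · simp

/-- Every function `c` is realized by a symmetry in `U_sym`. -/
lemma exists_mem_Usym (c : (Fin k → G) → G) :
    ∃ U ∈ Usym G k, ∀ h g, U.mulVec (ket (cfg h g)) = (trans (c h)).mulVec (ket (cfg h g)) := by
  let σ : (Fin (k + 1) → G) → Fin (k + 1) → G := fun x i => c (rel x) * x i
  have hσ : ∀ x y, σ x = σ y ↔ x = y := by
    intro x y
    rw [← cfg_rel x, ← cfg_rel y]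
    simp only [σ, mul_cfg, rel_cfg, cfg_inj]
    constructor
    · rintro ⟨e, e'⟩
      rw [e] at e'
      exact ⟨e, mul_left_cancel e'⟩
    · rintro ⟨e, e'⟩
      exact ⟨e, by rw [e, e']⟩
  let U : Op G (k + 1) := Matrix.of fun x y => if x = σ y then 1 else 0
  have hU : ∀ h g, U.mulVec (ket (cfg h g)) = (trans (c h)).mulVec (ket (cfg h g)) := by
    intro h g
    funext x
    rw [mulVec_ket, mulVec_ket]
    simp [U, σ, trans, rel_cfg]
  refine ⟨U, ⟨?_, c, hU⟩, hU⟩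
  rw [Matrix.mem_unitaryGroup_iff']
  ext x y
  simp [Matrix.mul_apply, Matrix.star_apply, U, Matrix.one_apply, apply_ite star, hσ, eq_comm]

lemma exists_sum_ket_iff (ψ : Vec G (k + 1)) :
    (∃ (c : (Fin k → G) → G) (α : (Fin k → G) → ℂ),
      ψ = ∑ h : Fin k → G, α h • ket (cfg h (c h))) ↔
    ∀ h : Fin k → G, ∃ g₀ : G, ∀ g : G, ψ (cfg h g) ≠ 0 → g = g₀ := by
  constructor
  · rintro ⟨c, α, rfl⟩ h
    refine ⟨c h, fun g hg => ?_⟩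
    rw [sum_ket_apply] at hg
    by_contra hne
    exact hg (if_neg hne)
  · intro H
    choose c hc using H
    refine ⟨c, fun h => ψ (cfg h (c h)), vec_ext fun h g => ?_⟩
    rw [sum_ket_apply]
    split_ifs with hg
    · rw [hg]
    · by_contra hne
      exact hg (hc h g hne)

lemma alignable_iff (ψ : Vec G (k + 1)) :
    Alignable ψ ↔ ∃ (c : (Fin k → G) → G) (α : (Fin k → G) → ℂ),
      ψ = ∑ h : Fin k → G, α h • ket (cfg h (c h)) := by
  constructor
  · rintro ⟨i, θ, U, φ, ⟨-, c, hU⟩, rfl⟩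
    rw [exists_sum_ket_iff]
    refine fun h => ⟨c h * (cfg h 1 i)⁻¹, fun g hg => ?_⟩
    rw [Pi.smul_apply, mulVec_cfg hU, insVec] at hg
    have hi : cfg h ((c h)⁻¹ * g) i = 1 := by
      by_contra hne
      simp [hne] at hg
    rw [cfg_apply] at hi
    rw [← inv_mul_eq_iff_eq_mul]
    exact eq_inv_of_mul_eq_one_right hi
  · rintro ⟨c, α, rfl⟩
    obtain ⟨U, hU, hc⟩ := exists_mem_Usym c
    refine ⟨0, 0, U, α, hU, vec_ext fun h g => ?_⟩
    rw [sum_ket_apply, Pi.smul_apply, mulVec_cfg hc]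
    by_cases hg : g = c h
    · simp [insVec, cfg, hg]
    · simp [insVec, cfg, inv_mul_eq_one, Ne.symm hg, hg]

lemma symmEquiv_sum_ket_iff (c c' : (Fin k → G) → G) (α α' : (Fin k → G) → ℂ) :
    SymmEquiv (∑ h : Fin k → G, α h • ket (cfg h (c h)))
        (∑ h : Fin k → G, α' h • ket (cfg h (c' h))) ↔
      ∃ θ : ℝ, ∀ h : Fin k → G, α' h = Complex.exp (θ * Complex.I) * α h := by
  constructor
  · rintro ⟨θ, U, ⟨-, d, hU⟩, e⟩
    refine ⟨θ, fun h => ?_⟩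
    have key : ∀ g, (if g = c' h then α' h else 0)
        = Complex.exp (θ * Complex.I) * if (d h)⁻¹ * g = c h then α h else 0 := by
      intro g
      rw [← sum_ket_apply, e, Pi.smul_apply, mulVec_cfg hU, sum_ket_apply, smul_eq_mul]
    by_cases hd : (d h)⁻¹ * c' h = c h
    · simpa [hd] using key (c' h)
    · have h₁ : α' h = 0 := by simpa [hd] using key (c' h)
      have h₂ := key (d h * c h)
      simpa [h₁] using h₂
  · rintro ⟨θ, hθ⟩
    obtain ⟨U, hU, hd⟩ := exists_mem_Usym fun h => c' h * (c h)⁻¹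
    refine ⟨θ, U, hU, vec_ext fun h g => ?_⟩
    have hiff : (c' h * (c h)⁻¹)⁻¹ * g = c h ↔ g = c' h := by
      rw [inv_mul_eq_iff_eq_mul, inv_mul_cancel_right]
    rw [Pi.smul_apply, mulVec_cfg hd, sum_ket_apply, sum_ket_apply, hθ]
    simp only [hiff, smul_eq_mul, mul_ite, mul_zero]

end Lemmas

/-- `ψ` is alignable iff `ψ = ∑_h α_h |c(h), h c(h)⟩` for some
`c : G^{N-1} → G` and coefficients `α`; equivalently, iff for every `h` the projection
of `ψ` onto `H_h` is a multiple of a single standard basis vector. Moreover, two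
alignable vectors are symmetry-equivalent iff their coefficient families agree up to
one global phase. -/
theorem stmt9 (G : Type) [Fintype G] [DecidableEq G] [CommGroup G] (n : ℕ) :
    (∀ ψ : Vec G (n + 1),
      Alignable ψ ↔ ∃ (c : (Fin n → G) → G) (α : (Fin n → G) → ℂ),
        ψ = ∑ h : Fin n → G, α h • ket (cfg h (c h))) ∧
    (∀ ψ : Vec G (n + 1),
      (∃ (c : (Fin n → G) → G) (α : (Fin n → G) → ℂ),
        ψ = ∑ h : Fin n → G, α h • ket (cfg h (c h))) ↔
      ∀ h : Fin n → G, ∃ g₀ : G, ∀ g : G, ψ (cfg h g) ≠ 0 → g = g₀) ∧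
    (∀ (ψ ψ' : Vec G (n + 1)) (c c' : (Fin n → G) → G) (α α' : (Fin n → G) → ℂ),
      ψ = ∑ h : Fin n → G, α h • ket (cfg h (c h)) →
      ψ' = ∑ h : Fin n → G, α' h • ket (cfg h (c' h)) →
      (SymmEquiv ψ ψ' ↔
        ∃ θ : ℝ, ∀ h : Fin n → G, α' h = Complex.exp (θ * Complex.I) * α h)) := by
  refine ⟨alignable_iff, exists_sum_ket_iff, ?_⟩
  rintro ψ ψ' c c' α α' rfl rfl
  exact symmEquiv_sum_ket_iff c c' α α'

end QRF

end
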